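/- Let S = {x ∈ ℝⁿ : g₁(x) ≥ 0, …, g_m(x) ≥ 0}. For every k ∈ ℕ one has conv(S) ⊆ Ω_k(G̃) and hence closure(conv(S)) ⊆ closure(Ω_k(G̃)) ⊆ TH̃_k(G̃). -/

import Mathlib

open MvPolynomial Pointwise

/-- Homogenization of a polynomial in variables `X₁,…,Xₙ` (indexed by `Fin n`, shifted to
`X₁,…,Xₙ` via `Fin.succ`) with a new homogenizing variable `X₀`. -/
noncomputable def homog {n : ℕ} (f : MvPolynomial (Fin n) ℝ) : MvPolynomial (Fin (n + 1)) ℝ :=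
  ∑ α ∈ f.support,
    MvPolynomial.monomial
      (Finsupp.mapDomain Fin.succ α + Finsupp.single 0 (f.totalDegree - α.sum fun _ e => e))
      (MvPolynomial.coeff α f)

/-- The `k`-th truncated quadratic module generated by the family `g`. -/
def QMod {τ ι : Type*} [Fintype ι] (k : ℕ) (g : ι → MvPolynomial τ ℝ) :
    Set (MvPolynomial τ ℝ) :=
  {p | ∃ s₀ : MvPolynomial τ ℝ, ∃ s : ι → MvPolynomial τ ℝ,
      IsSumSq s₀ ∧ s₀.totalDegree ≤ 2 * k ∧
      (∀ i, IsSumSq (s i) ∧ (s i * g i).totalDegree ≤ 2 * k) ∧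
      p = s₀ + ∑ i, s i * g i}

/-- The homogenized generating family `G̃`. -/
noncomputable def tGens {n : ℕ} {ι : Type*} (g : ι → MvPolynomial (Fin n) ℝ) :
    ι ⊕ Fin 3 → MvPolynomial (Fin (n + 1)) ℝ :=
  Sum.elim (fun j => homog (g j))
    ![X 0, (∑ i, X i ^ 2) - 1, 1 - ∑ i, X i ^ 2]

/-- The modified theta body `TH̃ₖ(G̃)`. -/
noncomputable def thetaB {n : ℕ} {ι : Type*} [Fintype ι] (k : ℕ)
    (g : ι → MvPolynomial (Fin n) ℝ) : Set (Fin n → ℝ) :=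
  {x | ∀ l ∈ QMod k (tGens g), l.IsHomogeneous 1 → 0 ≤ eval (Fin.cons 1 x) l}

/-- The Riesz functional of a truncated moment sequence. -/
noncomputable def riesz {m : ℕ} (y : (Fin m →₀ ℕ) → ℝ) (p : MvPolynomial (Fin m) ℝ) : ℝ :=
  ∑ α ∈ p.support, MvPolynomial.coeff α p * y α

/-- The moment relaxation `Ωₖ(G̃)`. -/
noncomputable def omegaRel {n : ℕ} {ι : Type*} [Fintype ι] (k : ℕ)
    (g : ι → MvPolynomial (Fin n) ℝ) : Set (Fin n → ℝ) :=
  {x | ∃ y : (Fin (n + 1) →₀ ℕ) → ℝ,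
      riesz y (X 0) = 1 ∧
      (∀ i : Fin n, riesz y (X i.succ) = x i) ∧
      (∀ q : MvPolynomial (Fin (n + 1)) ℝ, q.totalDegree ≤ k → 0 ≤ riesz y (q ^ 2)) ∧
      (∀ q : MvPolynomial (Fin (n + 1)) ℝ, q.totalDegree ≤ k - 1 → 0 ≤ riesz y (X 0 * q ^ 2)) ∧
      (∀ q : MvPolynomial (Fin (n + 1)) ℝ, q.totalDegree ≤ 2 * (k - 1) →
        riesz y (((∑ i, X i ^ 2) - 1) * q) = 0) ∧
      (∀ j : ι, ∀ q : MvPolynomial (Fin (n + 1)) ℝ,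
        q.totalDegree ≤ k - ((g j).totalDegree + 1) / 2 → 0 ≤ riesz y (homog (g j) * q ^ 2))}

/-- The basic semialgebraic set defined by the family `g`. -/
def semiS {n : ℕ} {ι : Type*} (g : ι → MvPolynomial (Fin n) ℝ) : Set (Fin n → ℝ) :=
  {x | ∀ j, 0 ≤ eval x (g j)}

/-- `S̃ᵒ`. -/
noncomputable def StO {n : ℕ} {ι : Type*} (g : ι → MvPolynomial (Fin n) ℝ) :
    Set (Fin (n + 1) → ℝ) :=
  {x | (∀ j, 0 ≤ eval x (homog (g j))) ∧ 0 < x 0}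

/-- `S̃ᶜ`. -/
noncomputable def StC {n : ℕ} {ι : Type*} (g : ι → MvPolynomial (Fin n) ℝ) :
    Set (Fin (n + 1) → ℝ) :=
  {x | (∀ j, 0 ≤ eval x (homog (g j))) ∧ 0 ≤ x 0}

/-- `S̃ = S̃ᶜ ∩ {‖x̃‖₂ = 1}`. -/
noncomputable def StS {n : ℕ} {ι : Type*} (g : ι → MvPolynomial (Fin n) ℝ) :
    Set (Fin (n + 1) → ℝ) :=
  {x | (∀ j, 0 ≤ eval x (homog (g j))) ∧ 0 ≤ x 0 ∧ ∑ i, x i ^ 2 = 1}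

/-- Assumption A: `S` is closed at infinity, and `conv(closure(S̃ᵒ))` is closed and pointed. -/
noncomputable def AssumpA {n : ℕ} {ι : Type*} (g : ι → MvPolynomial (Fin n) ℝ) : Prop :=
  closure (StO g) = StC g ∧ IsClosed (convexHull ℝ (closure (StO g))) ∧
    convexHull ℝ (closure (StO g)) ∩ -(convexHull ℝ (closure (StO g))) = {0}

/-- The PP-BDR property with order `k` for the set `T ⊆ ℝⁿ⁺¹` relative to the homogenized
generating family `tGens g`: outside a Lebesgue-null set of coefficient vectors, every affine
polynomial positive on `T` lies in the `k`-th truncated quadratic module of `G̃`. -/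
noncomputable def ppBDR {n : ℕ} {ι : Type*} [Fintype ι] (k : ℕ)
    (g : ι → MvPolynomial (Fin n) ℝ) (T : Set (Fin (n + 1) → ℝ)) : Prop :=
  MeasureTheory.volume {c : Fin (n + 2) → ℝ |
    (∀ x ∈ T, 0 < c 0 + ∑ i : Fin (n + 1), c i.succ * x i) ∧
    (C (c 0) + ∑ i : Fin (n + 1), C (c i.succ) * X i) ∉ QMod k (tGens g)} = 0

theorem riesz_eq_constr {m : ℕ} (y : (Fin m →₀ ℕ) → ℝ) (p : MvPolynomial (Fin m) ℝ) :
    riesz y p = (MvPolynomial.basisMonomials (Fin m) ℝ).constr ℝ y p := by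
  conv_rhs => rw [MvPolynomial.as_sum p]
  rw [map_sum, riesz]
  refine Finset.sum_congr rfl fun α _ => ?_
  have h : monomial α (coeff α p) = (coeff α p) • (MvPolynomial.basisMonomials (Fin m) ℝ) α := by
    rw [MvPolynomial.coe_basisMonomials, MvPolynomial.smul_monomial]; simp
  rw [h, map_smul, Module.Basis.constr_basis, smul_eq_mul]

theorem riesz_add {m : ℕ} (y : (Fin m →₀ ℕ) → ℝ) (p q : MvPolynomial (Fin m) ℝ) :
    riesz y (p + q) = riesz y p + riesz y q := by
  simp only [riesz_eq_constr, map_add]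

theorem riesz_neg {m : ℕ} (y : (Fin m →₀ ℕ) → ℝ) (p : MvPolynomial (Fin m) ℝ) :
    riesz y (-p) = - riesz y p := by
  simp only [riesz_eq_constr, map_neg]

theorem riesz_zero {m : ℕ} (y : (Fin m →₀ ℕ) → ℝ) :
    riesz y (0 : MvPolynomial (Fin m) ℝ) = 0 := by
  simp only [riesz_eq_constr, map_zero]

theorem riesz_sum {m : ℕ} {κ : Type*} (y : (Fin m →₀ ℕ) → ℝ) (T : Finset κ)
    (p : κ → MvPolynomial (Fin m) ℝ) :
    riesz y (∑ i ∈ T, p i) = ∑ i ∈ T, riesz y (p i) := by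
  simp only [riesz_eq_constr, map_sum]

theorem riesz_comb {m : ℕ} (y z : (Fin m →₀ ℕ) → ℝ) (a b : ℝ) (p : MvPolynomial (Fin m) ℝ) :
    riesz (a • y + b • z) p = a * riesz y p + b * riesz z p := by
  simp only [riesz, Finset.mul_sum, ← Finset.sum_add_distrib]
  refine Finset.sum_congr rfl fun α _ => ?_
  simp only [Pi.add_apply, Pi.smul_apply, smul_eq_mul]
  ring

theorem riesz_point {m : ℕ} (u : Fin m → ℝ) (c : ℝ) (p : MvPolynomial (Fin m) ℝ) :
    riesz (fun α => c * ∏ i, u i ^ α i) p = c * eval u p := by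
  rw [riesz, MvPolynomial.eval_eq', Finset.mul_sum]
  refine Finset.sum_congr rfl fun α _ => ?_
  ring

theorem eval_homog {n : ℕ} (f : MvPolynomial (Fin n) ℝ) (t : ℝ) (x : Fin n → ℝ) :
    eval (Fin.cons t (fun i => t * x i)) (homog f) = t ^ f.totalDegree * eval x f := by
  rw [homog, map_sum, MvPolynomial.eval_eq', Finset.mul_sum]
  refine Finset.sum_congr rfl fun α hα => ?_
  have hd : (α.sum fun _ e => e) ≤ f.totalDegree := MvPolynomial.le_totalDegree hα
  have hs : (α.sum fun _ e => e) = ∑ i, α i := Finsupp.sum_fintype _ _ (by simp)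
  rw [MvPolynomial.eval_monomial, Finsupp.prod_fintype _ _ (by simp), Fin.prod_univ_succ]
  have h0 : Finsupp.mapDomain Fin.succ α (0 : Fin (n + 1)) = 0 := by
    apply Finsupp.mapDomain_of_notMem_range
    rintro ⟨i, hi⟩
    exact Fin.succ_ne_zero i hi
  have h1 : ∀ i : Fin n, Finsupp.mapDomain Fin.succ α i.succ = α i := fun i =>
    Finsupp.mapDomain_apply (Fin.succ_injective n) α i
  have h2 : ∀ i : Fin n, (Finsupp.single (0 : Fin (n + 1))
      (f.totalDegree - α.sum fun _ e => e)) i.succ = 0 := fun i => by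
    rw [Finsupp.single_apply, if_neg (Fin.succ_ne_zero i).symm]
  simp only [Finsupp.add_apply, h0, h1, h2, Fin.cons_zero, Fin.cons_succ, zero_add, add_zero,
    Finsupp.single_eq_same, mul_pow, Finset.prod_mul_distrib, Finset.prod_pow_eq_pow_sum]
  rw [← hs]
  have h3 : t ^ f.totalDegree = t ^ (f.totalDegree - α.sum fun _ e => e) *
      t ^ (α.sum fun _ e => e) := by
    rw [← pow_add, Nat.sub_add_cancel hd]
  rw [h3]; ring

theorem homog_isHomogeneous {n : ℕ} (f : MvPolynomial (Fin n) ℝ) :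
    (homog f).IsHomogeneous f.totalDegree := by
  rw [homog]
  refine MvPolynomial.IsHomogeneous.sum _ _ _ fun α hα => ?_
  apply MvPolynomial.isHomogeneous_monomial
  have hd : (α.sum fun _ e => e) ≤ f.totalDegree := MvPolynomial.le_totalDegree hα
  have h1 : (Finsupp.mapDomain Fin.succ α).degree = α.sum fun _ e => e := by
    rw [Finsupp.degree_eq_sum, Finsupp.sum_fintype _ _ (by simp), Fin.sum_univ_succ]
    have h0 : Finsupp.mapDomain Fin.succ α (0 : Fin (n + 1)) = 0 := by
      apply Finsupp.mapDomain_of_notMem_range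
      rintro ⟨i, hi⟩
      exact Fin.succ_ne_zero i hi
    rw [h0, zero_add]
    exact Finset.sum_congr rfl fun i _ => Finsupp.mapDomain_apply (Fin.succ_injective n) α i
  rw [map_add, h1, Finsupp.degree_single]
  omega

theorem homog_ne_zero {n : ℕ} {f : MvPolynomial (Fin n) ℝ} (hf : f ≠ 0) : homog f ≠ 0 := by
  intro h
  apply hf
  apply MvPolynomial.funext
  intro x
  have := eval_homog f 1 x
  rw [h] at this
  simpa using this.symm

/-! Sums of squares have no degree cancellation. -/

theorem isSumSq_repr {σ : Type*} {s : MvPolynomial σ ℝ} (hs : IsSumSq s) :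
    ∃ (r : ℕ) (q : Fin r → MvPolynomial σ ℝ), s = ∑ i, q i ^ 2 := by
  induction hs with
  | zero => exact ⟨0, fun _ => 0, by simp⟩
  | sq_add a hs ih =>
    obtain ⟨r, q, rfl⟩ := ih
    exact ⟨r + 1, Fin.cons a q, by simp [Fin.sum_univ_succ, sq]⟩

theorem hc_sq {σ : Type*} {N : ℕ} (hN : 0 < N) (q : MvPolynomial σ ℝ)
    (hq : q.totalDegree ≤ N) :
    homogeneousComponent (2 * N) (q ^ 2) = (homogeneousComponent N q) ^ 2 := by
  set h := homogeneousComponent N q with hh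
  have hhom : h.IsHomogeneous N := homogeneousComponent_isHomogeneous N q
  have hr : (q - h).totalDegree < N := by
    rw [MvPolynomial.totalDegree, Finset.sup_lt_iff (by simpa using hN)]
    intro d hd
    by_contra hcon
    push Not at hcon
    rw [MvPolynomial.mem_support_iff, MvPolynomial.coeff_sub, hh,
      MvPolynomial.coeff_homogeneousComponent] at hd
    have hdd : d.degree = d.sum fun _ e => e := rfl
    rcases hcon.lt_or_eq with h1 | h1
    · rw [if_neg (by rw [hdd]; omega),
        MvPolynomial.coeff_eq_zero_of_totalDegree_lt (lt_of_le_of_lt hq h1)] at hd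
      simp at hd
    · rw [if_pos (by rw [hdd]; omega)] at hd
      simp at hd
  have e : q ^ 2 = h ^ 2 + (q - h) * (q + h) := by ring
  have h1 : (q + h).totalDegree ≤ N :=
    (MvPolynomial.totalDegree_add _ _).trans (max_le hq hhom.totalDegree_le)
  have h2 := MvPolynomial.totalDegree_mul (q - h) (q + h)
  rw [e, map_add, MvPolynomial.homogeneousComponent_eq_zero (2 * N) ((q - h) * (q + h)) (by omega),
    add_zero, MvPolynomial.homogeneousComponent_eq_self]
  have := hhom.pow 2
  rwa [mul_comm] at this

theorem hc_top_ne_zero {σ : Type*} (q : MvPolynomial σ ℝ) (hq : 0 < q.totalDegree) :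
    homogeneousComponent q.totalDegree q ≠ 0 := by
  intro h
  have hr : q.totalDegree < q.totalDegree := by
    conv_lhs => rw [MvPolynomial.totalDegree]
    rw [Finset.sup_lt_iff (by simpa using hq)]
    intro d hd
    refine lt_of_le_of_ne (MvPolynomial.le_totalDegree hd) fun hdd => ?_
    have h1 := congrArg (coeff d) h
    have hdd' : d.degree = q.totalDegree := hdd
    rw [MvPolynomial.coeff_homogeneousComponent, if_pos hdd'] at h1
    exact (MvPolynomial.mem_support_iff.mp hd) (by simpa using h1)
  exact lt_irrefl _ hr

theorem sumsq_deg {σ : Type*} {r N : ℕ} (q : Fin r → MvPolynomial σ ℝ)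
    (h : (∑ i, q i ^ 2).totalDegree ≤ 2 * N + 1) (i : Fin r) : (q i).totalDegree ≤ N := by
  by_contra hcon
  push Not at hcon
  obtain ⟨j, -, hj⟩ := Finset.exists_max_image Finset.univ (fun i => (q i).totalDegree)
    ⟨i, Finset.mem_univ i⟩
  have hij := hj i (Finset.mem_univ i)
  have hpos : 0 < (q j).totalDegree := by omega
  have h0 : homogeneousComponent (2 * (q j).totalDegree) (∑ i, q i ^ 2) = 0 :=
    MvPolynomial.homogeneousComponent_eq_zero _ _ (by omega)
  rw [map_sum, Finset.sum_congr rfl (fun l hl => hc_sq hpos (q l) (hj l hl))] at h0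
  apply hc_top_ne_zero (q j) hpos
  apply MvPolynomial.funext
  intro x
  have h1 := congrArg (eval x) h0
  rw [map_sum, map_zero] at h1
  simp only [map_pow] at h1
  rw [Finset.sum_eq_zero_iff_of_nonneg (fun _ _ => sq_nonneg _)] at h1
  simpa using h1 j (Finset.mem_univ j)

/-- Nonnegativity of a functional on `s * p` from nonnegativity on `p * q ^ 2`. -/
theorem riesz_mul_nonneg {m : ℕ} (y : (Fin m →₀ ℕ) → ℝ) (p s : MvPolynomial (Fin m) ℝ)
    (N : ℕ) (hs : IsSumSq s) (hd : s.totalDegree ≤ 2 * N + 1)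
    (H : ∀ q : MvPolynomial (Fin m) ℝ, q.totalDegree ≤ N → 0 ≤ riesz y (p * q ^ 2)) :
    0 ≤ riesz y (s * p) := by
  obtain ⟨r, q, rfl⟩ := isSumSq_repr hs
  rw [Finset.sum_mul, riesz_sum]
  refine Finset.sum_nonneg fun i _ => ?_
  rw [mul_comm]
  exact H _ (sumsq_deg q hd i)

theorem omegaRel_convex {n m : ℕ} (k : ℕ) (g : Fin m → MvPolynomial (Fin n) ℝ) :
    Convex ℝ (omegaRel k g) := by
  rintro x ⟨y, h1, h2, h3, h4, h5, h6⟩ x' ⟨y', h1', h2', h3', h4', h5', h6'⟩ a b ha hb hab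
  refine ⟨a • y + b • y', ?_, ?_, ?_, ?_, ?_, ?_⟩
  · rw [riesz_comb, h1, h1']; linarith
  · intro i; rw [riesz_comb, h2, h2']; simp
  · intro q hq; rw [riesz_comb]
    exact add_nonneg (mul_nonneg ha (h3 q hq)) (mul_nonneg hb (h3' q hq))
  · intro q hq; rw [riesz_comb]
    exact add_nonneg (mul_nonneg ha (h4 q hq)) (mul_nonneg hb (h4' q hq))
  · intro q hq; rw [riesz_comb, h5 q hq, h5' q hq]; simp
  · intro j q hq; rw [riesz_comb]
    exact add_nonneg (mul_nonneg ha (h6 j q hq)) (mul_nonneg hb (h6' j q hq))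

theorem semiS_subset {n m : ℕ} (k : ℕ) (g : Fin m → MvPolynomial (Fin n) ℝ) :
    semiS g ⊆ omegaRel k g := by
  intro x hx
  have hA : 0 < 1 + ∑ i, x i ^ 2 := by
    have : 0 ≤ ∑ i, x i ^ 2 := Finset.sum_nonneg fun i _ => sq_nonneg _
    linarith
  set c := Real.sqrt (1 + ∑ i, x i ^ 2) with hc
  have hc0 : 0 < c := Real.sqrt_pos.mpr hA
  have hc2 : c ^ 2 = 1 + ∑ i, x i ^ 2 := Real.sq_sqrt hA.le
  have hci : 0 < c⁻¹ := inv_pos.mpr hc0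
  set u : Fin (n + 1) → ℝ := Fin.cons c⁻¹ (fun i => c⁻¹ * x i) with hu
  have hu0 : u 0 = c⁻¹ := rfl
  have hus : ∀ i : Fin n, u i.succ = c⁻¹ * x i := fun i => rfl
  have hsph : ∑ i, u i ^ 2 = 1 := by
    rw [Fin.sum_univ_succ]
    simp only [hu0, hus, mul_pow]
    rw [← Finset.mul_sum]
    have : ∑ i, x i ^ 2 = c ^ 2 - 1 := by linarith
    rw [this]; field_simp; ring
  refine ⟨fun α => c * ∏ i, u i ^ α i, ?_, ?_, ?_, ?_, ?_, ?_⟩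
  · rw [riesz_point, eval_X, hu0]; field_simp
  · intro i; rw [riesz_point, eval_X, hus]; field_simp
  · intro q _; rw [riesz_point, map_pow]; positivity
  · intro q _; rw [riesz_point, map_mul, map_pow, eval_X, hu0]; positivity
  · intro q _; rw [riesz_point, map_mul, map_sub, map_sum]
    simp [hsph]
  · intro j q _; rw [riesz_point, map_mul, map_pow, hu, eval_homog]
    have := hx j
    positivity

theorem thetaB_closed {n m : ℕ} (k : ℕ) (g : Fin m → MvPolynomial (Fin n) ℝ) :
    IsClosed (thetaB k g) := by
  have : thetaB k g = ⋂ l ∈ QMod k (tGens g), ⋂ (_ : l.IsHomogeneous 1),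
      {x : Fin n → ℝ | 0 ≤ eval (Fin.cons 1 x : Fin (n + 1) → ℝ) l} := by
    ext x; simp [thetaB]
  rw [this]
  refine isClosed_iInter fun l => isClosed_iInter fun _ => isClosed_iInter fun _ => ?_
  refine isClosed_le continuous_const ?_
  refine (MvPolynomial.continuous_eval l).comp ?_
  refine continuous_pi fun i => ?_
  refine Fin.cases ?_ (fun i => ?_) i
  · exact continuous_const
  · exact continuous_apply i

theorem finsupp_degree_one {σ : Type*} (α : σ →₀ ℕ) (h : α.degree = 1) :
    ∃ i, α = Finsupp.single i 1 := by
  have hne : α ≠ 0 := by rintro rfl; simp at h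
  obtain ⟨i, hi⟩ := Finsupp.ne_iff.mp hne
  have hi1 : 1 ≤ α i := Nat.one_le_iff_ne_zero.mpr hi
  have hle : Finsupp.single i 1 ≤ α := by simpa using hi1
  have e : α = Finsupp.single i 1 + (α - Finsupp.single i 1) := (add_tsub_cancel_of_le hle).symm
  have h1 : (α - Finsupp.single i 1).degree = 0 := by
    have := congrArg Finsupp.degree e
    rw [map_add, Finsupp.degree_single] at this
    omega
  rw [Finsupp.degree_eq_zero_iff] at h1
  exact ⟨i, by rw [h1, add_zero] at e; exact e⟩

theorem riesz_linear {n : ℕ} (y : (Fin (n + 1) →₀ ℕ) → ℝ) (x : Fin n → ℝ)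
    (h1 : riesz y (X 0) = 1) (h2 : ∀ i : Fin n, riesz y (X i.succ) = x i)
    (l : MvPolynomial (Fin (n + 1)) ℝ) (hl : l.IsHomogeneous 1) :
    riesz y l = eval (Fin.cons 1 x : Fin (n + 1) → ℝ) l := by
  have hy : ∀ i, y (Finsupp.single i 1) = (Fin.cons 1 x : Fin (n + 1) → ℝ) i := by
    have hX : ∀ i : Fin (n + 1), riesz y (X i) = y (Finsupp.single i 1) := fun i => by
      rw [riesz, MvPolynomial.support_X]; simp
    intro i
    rw [← hX]
    refine Fin.cases ?_ (fun i => ?_) i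
    · rw [h1]; rfl
    · rw [h2]; rfl
  rw [riesz, MvPolynomial.eval_eq']
  refine Finset.sum_congr rfl fun α hα => ?_
  have hd : α.degree = 1 := by
    by_contra hne
    exact (MvPolynomial.mem_support_iff.mp hα) (hl.coeff_eq_zero hne)
  obtain ⟨i, rfl⟩ := finsupp_degree_one α hd
  rw [hy, Finset.prod_eq_single i]
  · simp
  · intro j _ hj
    rw [Finsupp.single_apply, if_neg (Ne.symm hj), pow_zero]
  · simp

theorem sph_ne {n : ℕ} : ((∑ i : Fin (n + 1), X i ^ 2) - 1 : MvPolynomial (Fin (n + 1)) ℝ) ≠ 0 := by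
  intro h
  have := congrArg (eval (fun _ => (0 : ℝ))) h
  simp at this

theorem sph_deg {n : ℕ} :
    2 ≤ ((∑ i : Fin (n + 1), X i ^ 2) - 1 : MvPolynomial (Fin (n + 1)) ℝ).totalDegree := by
  have hmem : Finsupp.single (0 : Fin (n + 1)) 2 ∈
      ((∑ i : Fin (n + 1), X i ^ 2) - 1 : MvPolynomial (Fin (n + 1)) ℝ).support := by
    rw [MvPolynomial.mem_support_iff, MvPolynomial.coeff_sub, MvPolynomial.coeff_sum,
      Finset.sum_eq_single 0]
    · rw [MvPolynomial.coeff_X_pow, MvPolynomial.coeff_one]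
      have : (0 : Fin (n + 1) →₀ ℕ) ≠ Finsupp.single 0 2 := by
        intro h
        have := DFunLike.congr_fun h 0
        simp at this
      simp [this]
    · intro j _ hj
      rw [MvPolynomial.coeff_X_pow, if_neg]
      intro h
      have := DFunLike.congr_fun h 0
      simp [hj] at this
    · simp
  have := MvPolynomial.le_totalDegree hmem
  simpa using this

theorem omegaRel_subset {n m : ℕ} (k : ℕ) (g : Fin m → MvPolynomial (Fin n) ℝ) :
    omegaRel k g ⊆ thetaB k g := by
  rintro x ⟨y, h1, h2, h3, h4, h5, h6⟩ l ⟨s₀, s, hs0, hs0d, hs, hl⟩ hhom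
  rw [← riesz_linear y x h1 h2 l hhom, hl, riesz_add, riesz_sum]
  have hsph : ∀ q : MvPolynomial (Fin (n + 1)) ℝ,
      (q * ((∑ i : Fin (n + 1), X i ^ 2) - 1)).totalDegree ≤ 2 * k →
      riesz y (q * ((∑ i : Fin (n + 1), X i ^ 2) - 1)) = 0 := by
    intro q hq
    by_cases h0 : q = 0
    · rw [h0, zero_mul, riesz_zero]
    rw [MvPolynomial.totalDegree_mul_of_isDomain h0 sph_ne] at hq
    have := sph_deg (n := n)
    rw [mul_comm]
    exact h5 q (by omega)
  refine add_nonneg ?_ (Finset.sum_nonneg fun i _ => ?_)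
  · have := riesz_mul_nonneg y 1 s₀ k hs0 (by omega) (fun q hq => by
      rw [one_mul]; exact h3 q hq)
    rwa [mul_one] at this
  · obtain ⟨hsi, hdi⟩ := hs i
    by_cases h0 : s i = 0
    · rw [h0, zero_mul, riesz_zero]
    rcases i with j | i
    · change 0 ≤ riesz y (s (Sum.inl j) * homog (g j))
      change (s (Sum.inl j) * homog (g j)).totalDegree ≤ 2 * k at hdi
      by_cases hg : g j = 0
      · have : homog (g j) = 0 := by rw [hg]; simp [homog]
        rw [this, mul_zero, riesz_zero]
      rw [MvPolynomial.totalDegree_mul_of_isDomain h0 (homog_ne_zero hg),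
        (homog_isHomogeneous (g j)).totalDegree (homog_ne_zero hg)] at hdi
      exact riesz_mul_nonneg y _ _ (k - ((g j).totalDegree + 1) / 2) hsi (by omega) (h6 j)
    · fin_cases i
      · change 0 ≤ riesz y (s (Sum.inr 0) * X 0)
        change (s (Sum.inr 0) * X 0).totalDegree ≤ 2 * k at hdi
        change ¬ s (Sum.inr 0) = 0 at h0
        rw [MvPolynomial.totalDegree_mul_of_isDomain h0 (MvPolynomial.X_ne_zero 0),
          MvPolynomial.totalDegree_X] at hdi
        exact riesz_mul_nonneg y _ _ (k - 1) hsi (by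
          change (s (Sum.inr 0)).totalDegree ≤ _
          omega) h4
      · exact (hsph _ hdi).ge
      · change 0 ≤ riesz y (s (Sum.inr 2) * (1 - ∑ i, X i ^ 2))
        change (s (Sum.inr 2) * (1 - ∑ i, X i ^ 2)).totalDegree ≤ 2 * k at hdi
        have e : s (Sum.inr 2) * (1 - ∑ i, X i ^ 2) =
            -(s (Sum.inr 2) * ((∑ i : Fin (n + 1), X i ^ 2) - 1)) := by ring
        rw [e, MvPolynomial.totalDegree_neg] at hdi
        rw [e, riesz_neg, hsph _ hdi, neg_zero]

/-- Theorem 3.9: for every `k`, `conv S ⊆ Ω_k(G̃)` and hence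
`closure (conv S) ⊆ closure (Ω_k(G̃)) ⊆ TH̃_k(G̃)`. -/
theorem stmt10 (n m : ℕ) (g : Fin m → MvPolynomial (Fin n) ℝ) :
    ∀ k : ℕ, convexHull ℝ (semiS g) ⊆ omegaRel k g ∧
      closure (convexHull ℝ (semiS g)) ⊆ closure (omegaRel k g) ∧
      closure (omegaRel k g) ⊆ thetaB k g := by
  intro k
  have h := convexHull_min (semiS_subset k g) (omegaRel_convex k g)
  exact ⟨h, closure_mono h, closure_minimal (omegaRel_subset k g) (thetaB_closed k g)⟩
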